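/- Let A be a primitive left-stochastic N×N real matrix with Perron eigenvector p and P = diag(p), and assume A satisfies the local balance condition P Aᵀ = A P. Let V be any symmetric real N×N matrix with V·V = (P − A P)/2. Then the null space of V equals the null space of P − A P, and both are spanned by the all-ones vector: for x ∈ ℝ^N, V x = 0 ⟺ (P − A P)x = 0 ⟺ x = c·𝟙_N for some constant c ∈ ℝ. -/

import Mathlib

open Matrix BigOperators

/-- A row vector fixed by `B` is fixed by every power of `B`. -/
theorem Matrix.vecMul_pow_eq_self {n R : Type*} [Fintype n] [DecidableEq n] [Semiring R]
    {B : Matrix n n R} {x : n → R} (hx : x ᵥ* B = x) (m : ℕ) : x ᵥ* B ^ m = x := by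
  induction m with
  | zero => simp
  | succ m ih => rw [pow_succ, ← Matrix.vecMul_vecMul, ih, hx]

/-- Maximum principle: a row vector fixed by an entrywise positive matrix that also fixes the
all-ones row vector is constant. -/
theorem Matrix.exists_eq_const_of_vecMul_eq_self {n : Type*} [Fintype n]
    {B : Matrix n n ℝ} (hpos : ∀ i j, 0 < B i j) (hone : 1 ᵥ* B = 1)
    {x : n → ℝ} (hx : x ᵥ* B = x) : ∃ c : ℝ, x = fun _ => c := by
  cases isEmpty_or_nonempty n
  · exact ⟨0, Subsingleton.elim _ _⟩
  obtain ⟨k, hk⟩ := Finite.exists_max x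
  have hcol : ∑ l, B l k = 1 := by
    simpa [Matrix.vecMul, dotProduct] using congrFun hone k
  have hfix : ∑ l, x l * B l k = x k := congrFun hx k
  have hsum : ∑ l, (x k - x l) * B l k = 0 := by
    simp_rw [sub_mul]
    rw [Finset.sum_sub_distrib, ← Finset.mul_sum, hcol, hfix, mul_one, sub_self]
  rw [Finset.sum_eq_zero_iff_of_nonneg fun l _ =>
    mul_nonneg (sub_nonneg.2 (hk l)) (hpos l k).le] at hsum
  refine ⟨x k, funext fun l => ?_⟩
  have := (mul_eq_zero.1 (hsum l (Finset.mem_univ l))).resolve_right (hpos l k).ne'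
  linarith

/-- A symmetric real matrix has the same null space as its square. -/
theorem Matrix.IsSymm.mul_self_mulVec_eq_zero {n : Type*} [Fintype n]
    {V : Matrix n n ℝ} (hV : V.IsSymm) (x : n → ℝ) : (V * V) *ᵥ x = 0 ↔ V *ᵥ x = 0 := by
  have h := Matrix.conjTranspose_mul_self_mulVec_eq_zero V x
  rwa [Matrix.conjTranspose_eq_transpose_of_trivial, hV.eq] at h

/-- For a balanced primitive left-stochastic matrix `A` and any symmetric
square root `V` of `(P - A P)/2`, the null space of `V` equals the null space of
`P - A P`, and both are spanned by the all-ones vector. -/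
theorem stmt8 {N : ℕ} (A : Matrix (Fin N) (Fin N) ℝ)
    (hA_nonneg : ∀ i j, 0 ≤ A i j)
    (hA_col : ∀ k, ∑ l, A l k = 1)
    (hA_prim : ∃ n : ℕ, 1 ≤ n ∧ ∀ i j, 0 < (A ^ n) i j)
    (p : Fin N → ℝ)
    (hp_pos : ∀ k, 0 < p k) (hp_sum : ∑ k, p k = 1)
    (hp_eig : A *ᵥ p = p)
    (hbal : Matrix.diagonal p * Aᵀ = A * Matrix.diagonal p)
    (V : Matrix (Fin N) (Fin N) ℝ) (hV_symm : V.IsSymm)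
    (hV_sq : V * V = (2 : ℝ)⁻¹ • (Matrix.diagonal p - A * Matrix.diagonal p)) :
    ∀ x : Fin N → ℝ,
      (V *ᵥ x = 0 ↔ (Matrix.diagonal p - A * Matrix.diagonal p) *ᵥ x = 0) ∧
      ((Matrix.diagonal p - A * Matrix.diagonal p) *ᵥ x = 0 ↔
        ∃ c : ℝ, x = fun _ => c) := by
  intro x
  constructor
  · rw [← hV_symm.mul_self_mulVec_eq_zero, hV_sq, Matrix.smul_mulVec,
      smul_eq_zero_iff_right (by norm_num)]
  have hker : (Matrix.diagonal p - A * Matrix.diagonal p) *ᵥ x = 0 ↔ x ᵥ* A = x := by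
    rw [← hbal, Matrix.sub_mulVec, ← Matrix.mulVec_mulVec, Matrix.mulVec_transpose,
      sub_eq_zero, funext_iff, funext_iff]
    refine forall_congr' fun k => ?_
    rw [Matrix.mulVec_diagonal, Matrix.mulVec_diagonal, mul_right_inj' (hp_pos k).ne', eq_comm]
  have hone : 1 ᵥ* A = 1 := by
    ext k
    simpa [Matrix.vecMul, dotProduct] using hA_col k
  rw [hker]
  constructor
  · intro hx
    obtain ⟨n, -, hn⟩ := hA_prim
    exact Matrix.exists_eq_const_of_vecMul_eq_self hn (Matrix.vecMul_pow_eq_self hone n)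
      (Matrix.vecMul_pow_eq_self hx n)
  · rintro ⟨c, rfl⟩
    ext k
    simp [Matrix.vecMul, dotProduct, ← Finset.mul_sum, hA_col k]
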